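/- Let u, v, w ∈ ℤ² satisfy det(u,v) = 1 and det(v,w) = 1, where for u = (u_1,u_2), v = (v_1,v_2) we write det(u,v) = u_1·v_2 − u_2·v_1. Then there exists a unique integer k such that u + w = k·v, and for this k one has det(u,v)·det(v,w)·det(w,u) = −k. -/

import Mathlib

/-- Determinant of the 2×2 integer matrix with columns `u` and `v`. -/
def det2 (u v : ℤ × ℤ) : ℤ := u.1 * v.2 - u.2 * v.1

/-- For vectors with `det(u,v) = det(v,w) = 1`, the relation `u + w = k • v` determines `k` as
`det(u,w)`, and holds for that value. -/
theorem add_eq_smul_iff_of_det2_eq_one {u v w : ℤ × ℤ} (huv : det2 u v = 1)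
    (hvw : det2 v w = 1) (k : ℤ) : u + w = k • v ↔ k = det2 u w := by
  obtain ⟨a, b⟩ := u
  obtain ⟨c, d⟩ := v
  obtain ⟨e, f⟩ := w
  simp only [det2, Prod.mk_add_mk, Prod.smul_mk, smul_eq_mul, Prod.mk.injEq] at *
  constructor
  · rintro ⟨h₁, h₂⟩
    linear_combination b * h₁ - a * h₂ - k * huv
  · rintro rfl
    constructor
    · linear_combination -a * hvw - e * huv
    · linear_combination -b * hvw - f * huv

/-- If `u, v, w ∈ ℤ²` satisfy `det(u,v) = 1` and `det(v,w) = 1`, then there is a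
unique integer `k` with `u + w = k • v`, and for this `k` the triple product of
determinants satisfies `det(u,v) * det(v,w) * det(w,u) = -k`. -/
theorem stmt1 (u v w : ℤ × ℤ) (huv : det2 u v = 1) (hvw : det2 v w = 1) :
    (∃! k : ℤ, u + w = k • v) ∧
    ∀ k : ℤ, u + w = k • v → det2 u v * det2 v w * det2 w u = -k := by
  simp only [add_eq_smul_iff_of_det2_eq_one huv hvw]
  refine ⟨⟨_, rfl, fun _ h => h⟩, ?_⟩
  rintro _ rfl
  rw [huv, hvw]
  simp only [det2]
  ring
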